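/- arXiv:1901.09288 — 5 statements merged into one kernel-verified Lean document; each statement's English description precedes it below -/
import Mathlib

section
/- Let κ ∈ [0,∞), c₀ ∈ (0,∞), c₁ ∈ ℝ, and r ∈ (3/4, ∞). Then the series Σ_{n=1}^∞ 2π²n²·(κ + c₀π²n²)^{−2r} converges, and for every continuously differentiable function v : [0,1] → ℝ, with F(v) ∈ L²((0,1); ℝ) denoting the (equivalence class of the) function x ↦ 2c₁·v(x)·v'(x) (that is, F(v) = c₁·(v²)'), it holds that Σ_{n=1}^∞ (κ + c₀π²n²)^{−2r} · ⟨F(v), e_n⟩² ≤ c₁² · (Σ_{n=1}^∞ 2π²n²·(κ + c₀π²n²)^{−2r}) · ‖v‖⁴. (In the spectral representation of the interpolation spaces associated to κ−A, where A is c₀ times the Dirichlet Laplacian on (0,1) with eigenvalues −c₀π²n² and eigenfunctions e_n, this says ‖F(v)‖_{H_{−r}} ≤ |c₁|·(Σ_{n=1}^∞ 2π²n²·(κ + c₀π²n²)^{−2r})^{1/2}·‖v‖² < ∞.) -/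
open MeasureTheory

theorem aux_summable (κ c₀ r : ℝ) (hκ : 0 ≤ κ) (hc₀ : 0 < c₀) (hr : 3 / 4 < r) :
    Summable (fun n : ℕ =>
      2 * Real.pi ^ 2 * ((n:ℝ) + 1) ^ 2 *
        (κ + c₀ * Real.pi ^ 2 * ((n:ℝ) + 1) ^ 2) ^ (-(2 * r))) := by
  have h1 : Summable (fun n : ℕ => (n:ℝ) ^ (2 - 4 * r)) :=
    Real.summable_nat_rpow.2 (by linarith)
  have h2 := (summable_nat_add_iff 1).2 h1
  have h3 := h2.mul_left (2 * Real.pi ^ 2 * (c₀ * Real.pi ^ 2) ^ (-(2 * r)))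
  refine Summable.of_nonneg_of_le (fun n => by positivity) (fun n => ?_) h3
  have hm : (0:ℝ) < (n:ℝ) + 1 := by positivity
  have hp := Real.pi_pos
  have h4 : (κ + c₀ * Real.pi ^ 2 * ((n:ℝ) + 1) ^ 2) ^ (-(2 * r)) ≤
      (c₀ * Real.pi ^ 2 * ((n:ℝ) + 1) ^ 2) ^ (-(2 * r)) :=
    Real.rpow_le_rpow_of_nonpos (by positivity) (by linarith) (by linarith)
  have h5 : (c₀ * Real.pi ^ 2 * ((n:ℝ) + 1) ^ 2) ^ (-(2 * r)) =
      (c₀ * Real.pi ^ 2) ^ (-(2 * r)) * ((n:ℝ) + 1) ^ (-(4 * r)) := by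
    rw [Real.mul_rpow (by positivity) (by positivity), ← Real.rpow_natCast ((n:ℝ)+1) 2,
      ← Real.rpow_mul hm.le]
    congr 2
    push_cast
    ring
  have h6 : ((n:ℝ) + 1) ^ (2 - 4 * r) = ((n:ℝ) + 1) ^ 2 * ((n:ℝ) + 1) ^ (-(4 * r)) := by
    rw [sub_eq_add_neg, Real.rpow_add hm, Real.rpow_two]
  push_cast
  rw [h6]
  calc _ ≤ 2 * Real.pi ^ 2 * ((n:ℝ) + 1) ^ 2 *
        (c₀ * Real.pi ^ 2 * ((n:ℝ) + 1) ^ 2) ^ (-(2 * r)) := by gcongr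
    _ = _ := by rw [h5]; ring

theorem aux_bound (c₁ : ℝ) (v v' : ℝ → ℝ)
    (hv : ∀ x ∈ Set.Icc (0:ℝ) 1, HasDerivWithinAt v (v' x) (Set.Icc 0 1) x)
    (hv' : ContinuousOn v' (Set.Icc 0 1)) (n : ℕ) :
    (∫ x in (0:ℝ)..1,
      (2 * c₁ * v x * v' x) * (Real.sqrt 2 * Real.sin (((n:ℝ) + 1) * Real.pi * x))) ^ 2 ≤
    c₁ ^ 2 * (2 * Real.pi ^ 2 * ((n:ℝ) + 1) ^ 2) * (∫ x in (0:ℝ)..1, v x ^ 2) ^ 2 := by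
  have hu : Set.uIcc (0:ℝ) 1 = Set.Icc 0 1 := Set.uIcc_of_le zero_le_one
  have hvc : ContinuousOn v (Set.Icc 0 1) := fun x hx => (hv x hx).continuousWithinAt
  set a : ℝ := ((n:ℝ) + 1) * Real.pi with ha
  have ha0 : 0 ≤ a := by positivity
  have hd1 : ∀ x ∈ Set.uIcc (0:ℝ) 1,
      HasDerivWithinAt (fun x => c₁ * v x ^ 2) (2 * c₁ * v x * v' x) (Set.uIcc 0 1) x := by
    rw [hu]
    intro x hx
    have := ((hv x hx).pow 2).const_mul c₁
    refine this.congr_deriv ?_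
    push_cast
    ring
  have hd2 : ∀ x ∈ Set.uIcc (0:ℝ) 1,
      HasDerivWithinAt (fun x => Real.sqrt 2 * Real.sin (a * x))
        (Real.sqrt 2 * (a * Real.cos (a * x))) (Set.uIcc 0 1) x := by
    intro x _
    have h := (((hasDerivAt_id x).const_mul a).sin.const_mul (Real.sqrt 2)).hasDerivWithinAt
      (s := Set.uIcc 0 1)
    refine h.congr_deriv ?_
    simp
    ring
  have hi1 : IntervalIntegrable (fun x => 2 * c₁ * v x * v' x) volume 0 1 := by
    apply ContinuousOn.intervalIntegrable
    rw [hu]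
    fun_prop
  have hi2 : IntervalIntegrable (fun x => Real.sqrt 2 * (a * Real.cos (a * x))) volume 0 1 := by
    apply Continuous.intervalIntegrable
    fun_prop
  have hibp := intervalIntegral.integral_deriv_mul_eq_sub_of_hasDerivWithinAt hd1 hd2 hi1 hi2
  have hsin : Real.sin a = 0 := by
    have := Real.sin_nat_mul_pi (n + 1)
    push_cast at this
    exact this
  have hj1 : IntervalIntegrable (fun x => 2 * c₁ * v x * v' x * (Real.sqrt 2 * Real.sin (a * x)))
      volume 0 1 := by
    apply ContinuousOn.intervalIntegrable
    rw [hu]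
    fun_prop
  have hj2 : IntervalIntegrable
      (fun x => c₁ * v x ^ 2 * (Real.sqrt 2 * (a * Real.cos (a * x)))) volume 0 1 := by
    apply ContinuousOn.intervalIntegrable
    rw [hu]
    fun_prop
  rw [intervalIntegral.integral_add hj1 hj2] at hibp
  simp only [mul_one, mul_zero, hsin, Real.sin_zero, sub_zero] at hibp
  have e1 := eq_neg_of_add_eq_zero_left hibp
  rw [e1, neg_sq]
  have e2 : (∫ x in (0:ℝ)..1, c₁ * v x ^ 2 * (Real.sqrt 2 * (a * Real.cos (a * x)))) =
      (c₁ * Real.sqrt 2 * a) * ∫ x in (0:ℝ)..1, v x ^ 2 * Real.cos (a * x) := by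
    rw [← intervalIntegral.integral_const_mul]
    congr 1
    ext x
    ring
  have e3 : |∫ x in (0:ℝ)..1, v x ^ 2 * Real.cos (a * x)| ≤ ∫ x in (0:ℝ)..1, v x ^ 2 := by
    rw [← Real.norm_eq_abs]
    apply intervalIntegral.norm_integral_le_of_norm_le zero_le_one
    · refine Filter.Eventually.of_forall fun x _ => ?_
      rw [norm_mul, Real.norm_eq_abs, Real.norm_eq_abs, abs_of_nonneg (sq_nonneg (v x))]
      exact mul_le_of_le_one_right (sq_nonneg _) (Real.abs_cos_le_one _)
    · apply ContinuousOn.intervalIntegrable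
      rw [hu]
      fun_prop
  have e4 : (∫ x in (0:ℝ)..1, v x ^ 2 * Real.cos (a * x)) ^ 2 ≤ (∫ x in (0:ℝ)..1, v x ^ 2) ^ 2 :=
    sq_le_sq' (abs_le.1 e3).1 (abs_le.1 e3).2
  have e5 : c₁ ^ 2 * (2 * Real.pi ^ 2 * ((n:ℝ) + 1) ^ 2) = (c₁ * Real.sqrt 2 * a) ^ 2 := by
    rw [mul_pow, mul_pow, Real.sq_sqrt (by norm_num), ha]
    ring
  rw [e2, e5, mul_pow]
  gcongr

/-- `H_{-r}`-bound for the Burgers nonlinearity `F(v) = c₁ (v²)'`.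
Here `e_n(x) = √2 sin((n+1)πx)`, `n : ℕ`, are the eigenfunctions of the Dirichlet
Laplacian on `(0,1)`, and inner products/norms are those of `L²((0,1);ℝ)`,
written as integrals. -/
theorem stmt5 (κ c₀ c₁ r : ℝ) (hκ : 0 ≤ κ) (hc₀ : 0 < c₀) (hr : 3 / 4 < r)
    (v v' : ℝ → ℝ)
    (hv : ∀ x ∈ Set.Icc (0:ℝ) 1, HasDerivWithinAt v (v' x) (Set.Icc 0 1) x)
    (hv' : ContinuousOn v' (Set.Icc 0 1)) :
    Summable (fun n : ℕ =>
      2 * Real.pi ^ 2 * ((n:ℝ) + 1) ^ 2 *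
        (κ + c₀ * Real.pi ^ 2 * ((n:ℝ) + 1) ^ 2) ^ (-(2 * r))) ∧
    Summable (fun n : ℕ =>
      (κ + c₀ * Real.pi ^ 2 * ((n:ℝ) + 1) ^ 2) ^ (-(2 * r)) *
        (∫ x in (0:ℝ)..1,
          (2 * c₁ * v x * v' x) * (Real.sqrt 2 * Real.sin (((n:ℝ) + 1) * Real.pi * x))) ^ 2) ∧
    ∑' n : ℕ,
        (κ + c₀ * Real.pi ^ 2 * ((n:ℝ) + 1) ^ 2) ^ (-(2 * r)) *
          (∫ x in (0:ℝ)..1,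
            (2 * c₁ * v x * v' x) * (Real.sqrt 2 * Real.sin (((n:ℝ) + 1) * Real.pi * x))) ^ 2 ≤
      c₁ ^ 2 *
        (∑' n : ℕ,
          2 * Real.pi ^ 2 * ((n:ℝ) + 1) ^ 2 *
            (κ + c₀ * Real.pi ^ 2 * ((n:ℝ) + 1) ^ 2) ^ (-(2 * r))) *
        (∫ x in (0:ℝ)..1, v x ^ 2) ^ 2 := by
  have hS := aux_summable κ c₀ r hκ hc₀ hr
  have hle : ∀ n : ℕ, (κ + c₀ * Real.pi ^ 2 * ((n:ℝ) + 1) ^ 2) ^ (-(2 * r)) *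
        (∫ x in (0:ℝ)..1,
          (2 * c₁ * v x * v' x) * (Real.sqrt 2 * Real.sin (((n:ℝ) + 1) * Real.pi * x))) ^ 2 ≤
      c₁ ^ 2 * (2 * Real.pi ^ 2 * ((n:ℝ) + 1) ^ 2 *
        (κ + c₀ * Real.pi ^ 2 * ((n:ℝ) + 1) ^ 2) ^ (-(2 * r))) *
        (∫ x in (0:ℝ)..1, v x ^ 2) ^ 2 := by
    intro n
    have h := mul_le_mul_of_nonneg_left (aux_bound c₁ v v' hv hv' n)
      (show 0 ≤ (κ + c₀ * Real.pi ^ 2 * ((n:ℝ) + 1) ^ 2) ^ (-(2 * r)) by positivity)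
    refine h.trans (le_of_eq ?_)
    ring
  have hS2 := (hS.mul_left (c₁ ^ 2)).mul_right ((∫ x in (0:ℝ)..1, v x ^ 2) ^ 2)
  have hS3 := Summable.of_nonneg_of_le (fun n => by positivity) hle hS2
  refine ⟨hS, hS3, ?_⟩
  rw [← tsum_mul_left, ← tsum_mul_right]
  exact hS3.tsum_le_tsum hle hS2
end

section
/- Let κ ∈ [0,∞), T ∈ (0,∞), a ∈ [0,1), and ε ∈ (0, 1−a]. Then for all s ∈ [0,T), t ∈ (s,T], and x ∈ [0,∞) it holds that s^{a+ε} · x^a · e^{s(κ−x)} · |e^{(t−s)(κ−x)} − 1| ≤ max{1, T^ε} · e^{Tκ} · (e^{(t−s)κ} − 1 + (t−s)^ε), where for a = 0 the factor x^a is interpreted as 1 (also at x = 0). (In the diagonal spectral setting, with x = κ+λ ranging over the shifted eigenvalues of an operator −A with eigenvalues −λ ≤ min{η,κ}-bounds, this scalar inequality expresses the semigroup Hölder-continuity estimate s^{a+ε}·‖e^{tA} − e^{sA}‖_{L(H_{−α},H_ρ)} ≤ max{1,T^ε}·e^{Tκ}·(e^{(t−s)κ} − 1 + (t−s)^ε)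 with a = α+ρ.) -/
lemma aux1 (y p : ℝ) (hy : 0 ≤ y) (hp : 0 ≤ p) (hp1 : p ≤ 1) : y ^ p * Real.exp (-y) ≤ 1 := by
  have h : y ^ p ≤ Real.exp y := by
    rcases le_total y 1 with h | h
    · exact (Real.rpow_le_one hy h hp).trans (Real.one_le_exp hy)
    · have h1 := Real.rpow_le_rpow_of_exponent_le h hp1
      rw [Real.rpow_one] at h1
      linarith [Real.add_one_le_exp y]
  rw [Real.exp_neg, ← div_eq_mul_inv]
  exact (div_le_one (Real.exp_pos y)).2 h

lemma aux2 (y p : ℝ) (hy : 0 ≤ y) (hp : 0 < p) (hp1 : p ≤ 1) : 1 - Real.exp (-y) ≤ y ^ p := by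
  rcases le_total y 1 with h | h
  · rcases hy.eq_or_lt with h0 | h0
    · subst h0; simp [Real.zero_rpow hp.ne']
    · have h1 := Real.rpow_le_rpow_of_exponent_ge h0 h hp1
      rw [Real.rpow_one] at h1
      linarith [Real.add_one_le_exp (-y)]
  · linarith [Real.one_le_rpow h hp.le, Real.exp_pos (-y)]

/-- scalar semigroup Hölder-continuity estimate. -/
theorem stmt7 (κ T a ε : ℝ) (hκ : 0 ≤ κ) (hT : 0 < T)
    (ha : a ∈ Set.Ico (0:ℝ) 1) (hε : ε ∈ Set.Ioc (0:ℝ) (1 - a)) :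
    ∀ s ∈ Set.Ico (0:ℝ) T, ∀ t ∈ Set.Ioc s T, ∀ x : ℝ, 0 ≤ x →
      s ^ (a + ε) * x ^ a * Real.exp (s * (κ - x)) * |Real.exp ((t - s) * (κ - x)) - 1| ≤
        max 1 (T ^ ε) * Real.exp (T * κ) * (Real.exp ((t - s) * κ) - 1 + (t - s) ^ ε) := by
  intro s hs t ht x hx
  obtain ⟨ha0, ha1⟩ := ha
  obtain ⟨he0, he1⟩ := hε
  obtain ⟨hs0, hsT⟩ := hs
  obtain ⟨hst, htT⟩ := ht
  have hh : 0 < t - s := by linarith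
  generalize t - s = h at *
  have hhx : 0 ≤ h * x := by positivity
  have hsx : 0 ≤ s * x := by positivity
  have hA : 0 ≤ Real.exp (h * κ) - 1 := by
    linarith [Real.one_le_exp (show 0 ≤ h * κ by positivity)]
  have habs : |Real.exp (h * (κ - x)) - 1| ≤ (Real.exp (h * κ) - 1) + (h * x) ^ ε := by
    have e : Real.exp (h * (κ - x)) = Real.exp (h * κ) * Real.exp (-(h * x)) := by
      rw [← Real.exp_add]; ring_nf
    have h2 := aux2 (h * x) ε hhx he0 (by linarith)
    have h3 : Real.exp (-(h * x)) ≤ 1 := Real.exp_le_one_iff.2 (by linarith)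
    have h4 := Real.exp_pos (-(h * x))
    have h5 : 0 ≤ (h * x) ^ ε := by positivity
    rw [e, abs_le]
    constructor <;> nlinarith
  have e2 : Real.exp (s * (κ - x)) = Real.exp (s * κ) * Real.exp (-(s * x)) := by
    rw [← Real.exp_add]; ring_nf
  have b1 : s ^ (a + ε) * x ^ a * Real.exp (-(s * x)) ≤ max 1 (T ^ ε) := by
    have q := aux1 (s * x) a hsx ha0 ha1.le
    have q2 : s ^ ε ≤ T ^ ε := Real.rpow_le_rpow hs0 hsT.le he0.le
    rw [Real.rpow_add_of_nonneg hs0 ha0 he0.le]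
    rw [Real.mul_rpow hs0 hx] at q
    have q3 : 0 ≤ s ^ ε := by positivity
    calc _ = s ^ ε * (s ^ a * x ^ a * Real.exp (-(s * x))) := by ring
      _ ≤ s ^ ε * 1 := by gcongr
      _ ≤ T ^ ε := by linarith
      _ ≤ _ := le_max_right _ _
  have b2 : s ^ (a + ε) * x ^ a * Real.exp (-(s * x)) * (h * x) ^ ε ≤ max 1 (T ^ ε) * h ^ ε := by
    have q := aux1 (s * x) (a + ε) hsx (by linarith) (by linarith)
    rw [Real.mul_rpow hs0 hx, Real.rpow_add_of_nonneg hx ha0 he0.le] at q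
    rw [Real.mul_rpow hh.le hx]
    calc _ = (s ^ (a + ε) * (x ^ a * x ^ ε) * Real.exp (-(s * x))) * h ^ ε := by ring
      _ ≤ _ := by
        gcongr
        exact q.trans (le_max_left _ _)
  have b3 : Real.exp (s * κ) ≤ Real.exp (T * κ) := by gcongr
  have hp : 0 ≤ h ^ ε := by positivity
  have hm : 0 ≤ max 1 (T ^ ε) := le_trans zero_le_one (le_max_left _ _)
  calc _ ≤ s ^ (a + ε) * x ^ a * Real.exp (s * (κ - x)) * ((Real.exp (h * κ) - 1) + (h * x) ^ ε) := by
        gcongr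
    _ = Real.exp (s * κ) * (s ^ (a + ε) * x ^ a * Real.exp (-(s * x)) * (Real.exp (h * κ) - 1)
        + s ^ (a + ε) * x ^ a * Real.exp (-(s * x)) * (h * x) ^ ε) := by rw [e2]; ring
    _ ≤ Real.exp (s * κ) * (max 1 (T ^ ε) * (Real.exp (h * κ) - 1) + max 1 (T ^ ε) * h ^ ε) := by
        gcongr
    _ ≤ Real.exp (T * κ) * (max 1 (T ^ ε) * (Real.exp (h * κ) - 1) + max 1 (T ^ ε) * h ^ ε) := by
        gcongr
    _ = _ := by ring
end

section
/- Let T, c ∈ (0,∞), ε ∈ [0,∞), χ ∈ (0,∞), h ∈ (0,T], γ ∈ (0,1), and ϱ ∈ [0, 1−γ). Let F : H → H be continuous with ‖F(v)‖_{H_{−γ}} ≤ c(2ε + ‖v‖_H²) for all v ∈ H, and let Y, O, 𝕆 : [0,T] → H be functions such that for all t ∈ [0,T]: Y_t = ∫₀ᵗ e^{(t−s)A} · 1_{[0, h^{−χ}]}(‖Y_{⌊s⌋_h}‖_{H_ϱ} + ‖O_{⌊s⌋_h}‖_{H_ϱ}) · F(Y_{⌊s⌋_h}) ds + O_t. Then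 for every t ∈ [0,T]: ‖Y_t − O_t‖_{H_ϱ} ≤ 2c · [ ε + sup_{s∈[0,T]} ‖Y_{⌊s⌋_h} − 𝕆_{⌊s⌋_h}‖_H² + sup_{s∈[0,T]} ‖𝕆_{⌊s⌋_h}‖_H² ] · e^{tκ} · t^{1−ϱ−γ} / (1−ϱ−γ). -/
open MeasureTheory

/-- `⌊t⌋_h = max{kh : k ∈ ℤ, kh ≤ t}`. -/
noncomputable def fl (h t : ℝ) : ℝ := h * ⌊t / h⌋

/-- The interpolation norm `‖v‖_{H_r} = (Σ_i (κ+λ_i)^{2r} ⟨b_i, v⟩²)^{1/2}`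
associated to `κ - A` for the diagonal operator `A b_i = -λ_i b_i`. -/
noncomputable def Hnorm {I H : Type*} [NormedAddCommGroup H] [InnerProductSpace ℝ H]
    (b : HilbertBasis I ℝ H) (κ : ℝ) (lam : I → ℝ) (r : ℝ) (v : H) : ℝ :=
  Real.sqrt (∑' i, (κ + lam i) ^ (2 * r) * (inner ℝ (b i) v : ℝ) ^ 2)

lemma rpow_le_bd {x δ M r : ℝ} (hδ : 0 < δ) (h1 : δ ≤ x) (h2 : x ≤ M) :
    x ^ r ≤ δ ^ r + M ^ r := by
  have hx : 0 < x := by linarith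
  have hM : 0 < M := by linarith
  have := Real.rpow_nonneg hδ.le r
  have := Real.rpow_nonneg hM.le r
  rcases le_total 0 r with hr | hr
  · have := Real.rpow_le_rpow hx.le h2 hr
    linarith
  · have := Real.rpow_le_rpow_of_nonpos hδ h1 hr
    linarith

lemma summable_inner_sq {I H : Type*} [NormedAddCommGroup H] [InnerProductSpace ℝ H]
    (b : HilbertBasis I ℝ H) (v : H) : Summable (fun i => (inner ℝ (b i) v : ℝ) ^ 2) := by
  have := b.orthonormal.inner_products_summable v
  simpa using this

lemma summable_wt {I H : Type*} [NormedAddCommGroup H] [InnerProductSpace ℝ H]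
    (b : HilbertBasis I ℝ H) (v : H) (w : I → ℝ) (C : ℝ) (h0 : ∀ i, 0 ≤ w i) (hC : ∀ i, w i ≤ C) :
    Summable (fun i => w i * (inner ℝ (b i) v : ℝ) ^ 2) := by
  refine Summable.of_nonneg_of_le (fun i => mul_nonneg (h0 i) (sq_nonneg _))
    (fun i => mul_le_mul_of_nonneg_right (hC i) (sq_nonneg _)) ((summable_inner_sq b v).mul_left C)

lemma exists_diag {I H : Type*} [NormedAddCommGroup H] [InnerProductSpace ℝ H]
    (b : HilbertBasis I ℝ H) (m : I → ℝ) (C : ℝ) (h0 : ∀ i, 0 ≤ m i) (hC : ∀ i, m i ≤ C) :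
    ∃ D : H →L[ℝ] H, ∀ v, ‖D v‖ = Real.sqrt (∑' i, (m i) ^ 2 * (inner ℝ (b i) v : ℝ) ^ 2) := by
  have hsum : ∀ v, Summable (fun i => (m i) ^ 2 * (inner ℝ (b i) v : ℝ) ^ 2) := fun v =>
    summable_wt b v _ (C ^ 2) (fun i => sq_nonneg _) (fun i => pow_le_pow_left₀ (h0 i) (hC i) 2)
  have hmem : ∀ v, Memℓp (fun i => m i * b.repr v i) 2 := by
    intro v
    rw [memℓp_gen_iff (by norm_num)]
    have := hsum v
    simpa [HilbertBasis.repr_apply_apply, mul_pow] using this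
  let L : H →ₗ[ℝ] H :=
    { toFun := fun v => b.repr.symm ⟨fun i => m i * b.repr v i, hmem v⟩
      map_add' := by
        intro x y
        rw [← map_add]
        congr 1
        ext i
        simp [mul_add]
        rfl
      map_smul' := by
        intro a x
        rw [RingHom.id_apply, ← map_smul]
        congr 1
        ext i
        simp
        ring }
  have hL : ∀ v, ‖L v‖ = Real.sqrt (∑' i, (m i) ^ 2 * (inner ℝ (b i) v : ℝ) ^ 2) := by
    intro v
    have : ‖L v‖ = ‖(⟨fun i => m i * b.repr v i, hmem v⟩ : lp (fun _ : I => ℝ) 2)‖ :=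
      b.repr.symm.norm_map _
    rw [this, lp.norm_eq_tsum_rpow (by norm_num)]
    simp [HilbertBasis.repr_apply_apply, mul_pow, Real.sqrt_eq_rpow]
  refine ⟨L.mkContinuous |C| ?_, fun v => hL v⟩
  intro v
  rw [hL v]
  have hn : ‖v‖ = Real.sqrt (∑' i, (inner ℝ (b i) v : ℝ) ^ 2) := by
    rw [← b.repr.norm_map v, lp.norm_eq_tsum_rpow (by norm_num)]
    simp [HilbertBasis.repr_apply_apply, Real.sqrt_eq_rpow]
  rw [hn, ← Real.sqrt_sq_eq_abs, ← Real.sqrt_mul (sq_nonneg _), ← tsum_mul_left]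
  apply Real.sqrt_le_sqrt
  exact (hsum v).tsum_le_tsum (fun i => mul_le_mul_of_nonneg_right
    (pow_le_pow_left₀ (h0 i) (hC i) 2) (sq_nonneg _)) ((summable_inner_sq b v).mul_left _)

lemma inner_S {I H : Type*} [NormedAddCommGroup H] [InnerProductSpace ℝ H]
    (b : HilbertBasis I ℝ H) (S : H →L[ℝ] H) (e : I → ℝ) (hS : ∀ i, S (b i) = e i • b i)
    (v : H) (i : I) : (inner ℝ (b i) (S v) : ℝ) = e i * inner ℝ (b i) v := by
  classical
  have h1 := ((b.hasSum_repr v).mapL S).mapL (innerSL ℝ (b i))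
  have h2 := hasSum_single (f := fun j => (innerSL ℝ (b i)) (S (b.repr v j • b j))) i (by
    intro j hj
    simp [hS, inner_smul_right, b.orthonormal.2 hj.symm])
  have := h1.unique h2
  simp [hS, inner_smul_right, HilbertBasis.repr_apply_apply, b.orthonormal.1 i] at this
  rw [this]; ring

lemma smoothing {x τ t κ a : ℝ} (hx : 0 < x) (hτ : 0 < τ) (hτt : τ ≤ t) (hκ : 0 ≤ κ)
    (ha0 : 0 ≤ a) (ha : a ≤ 1) :
    x ^ a * Real.exp (-(τ * (x - κ))) ≤ Real.exp (t * κ) * τ ^ (-a) := by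
  have h1 : (τ * x) ^ a ≤ Real.exp (τ * x) := by
    have hp : 0 < τ * x := by positivity
    have h3 : (τ * x) ^ a ≤ (1 + τ * x) ^ a := Real.rpow_le_rpow hp.le (by linarith) ha0
    have h4 : (1 + τ * x) ^ a ≤ (1 + τ * x) ^ (1 : ℝ) :=
      Real.rpow_le_rpow_of_exponent_le (by linarith) ha
    rw [Real.rpow_one] at h4
    have := Real.add_one_le_exp (τ * x)
    linarith
  rw [Real.mul_rpow hτ.le hx.le] at h1
  have h2 : Real.exp (τ * κ) ≤ Real.exp (t * κ) :=
    Real.exp_le_exp.2 (mul_le_mul_of_nonneg_right hτt hκ)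
  have hτa : 0 < τ ^ a := Real.rpow_pos_of_pos hτ a
  rw [Real.rpow_neg hτ.le]
  rw [show -(τ * (x - κ)) = τ * κ - τ * x by ring, Real.exp_sub]
  rw [← div_eq_mul_inv, le_div_iff₀ hτa]
  have he := Real.exp_pos (τ * x)
  have : x ^ a * (Real.exp (τ * κ) / Real.exp (τ * x)) * τ ^ a
      = Real.exp (τ * κ) * ((τ ^ a * x ^ a) / Real.exp (τ * x)) := by ring
  rw [this]
  have h5 : (τ ^ a * x ^ a) / Real.exp (τ * x) ≤ 1 := (div_le_one he).2 h1
  calc _ ≤ Real.exp (τ * κ) * 1 := by gcongr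
    _ ≤ _ := by linarith

lemma bdd_fl (T h : ℝ) (hh : 0 < h) (g : ℝ → ℝ) :
    BddAbove (Set.range (fun s : Set.Icc (0:ℝ) T => g (fl h ↑s))) := by
  have hfin : ((fun k : ℤ => g (h * k)) '' Set.Icc ⌊(0:ℝ) / h⌋ ⌊T / h⌋).Finite :=
    (Set.finite_Icc _ _).image _
  refine hfin.bddAbove.mono ?_
  rintro _ ⟨⟨s, hs⟩, rfl⟩
  refine ⟨⌊s / h⌋, ⟨Int.floor_le_floor ?_, Int.floor_le_floor ?_⟩, rfl⟩
  · exact div_le_div_of_nonneg_right hs.1 hh.le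
  · exact div_le_div_of_nonneg_right hs.2 hh.le

/-- the basic `H_ϱ` a priori estimate for the truncated scheme
(first part of the proof of Lemma 2.1).  Here `S t = e^{tA}`. -/
theorem stmt8 {I H : Type*} [Countable I] [NormedAddCommGroup H]
    [InnerProductSpace ℝ H] [CompleteSpace H]
    (b : HilbertBasis I ℝ H) (η κ : ℝ) (lam : I → ℝ)
    (hη : 0 ≤ η) (hκ : 0 ≤ κ)
    (hinf : ∃ δ > (0:ℝ), ∀ i, -(min η κ) + δ ≤ lam i)
    (hbdd : ∃ C : ℝ, ∀ i, |lam i| ≤ C)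
    (S : ℝ → H →L[ℝ] H)
    (hS : ∀ t : ℝ, 0 ≤ t → ∀ i, S t (b i) = Real.exp (-(t * lam i)) • b i)
    (T c ε χ h γ ϱ : ℝ)
    (hT : 0 < T) (hc : 0 < c) (hε : 0 ≤ ε) (hχ : 0 < χ) (hh : h ∈ Set.Ioc 0 T)
    (hγ : γ ∈ Set.Ioo (0:ℝ) 1) (hϱ : ϱ ∈ Set.Ico 0 (1 - γ))
    (F : H → H) (hF : Continuous F)
    (hFγ : ∀ v, Hnorm b κ lam (-γ) (F v) ≤ c * (2 * ε + ‖v‖ ^ 2))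
    (Y O 𝕆 : ℝ → H)
    (hY : ∀ t ∈ Set.Icc (0:ℝ) T,
      Y t = (∫ s in (0:ℝ)..t,
          if Hnorm b κ lam ϱ (Y (fl h s)) + Hnorm b κ lam ϱ (O (fl h s)) ≤ h ^ (-χ)
          then S (t - s) (F (Y (fl h s))) else 0) + O t) :
    ∀ t ∈ Set.Icc (0:ℝ) T,
      Hnorm b κ lam ϱ (Y t - O t) ≤
        2 * c * (ε + (⨆ s : Set.Icc (0:ℝ) T, ‖Y (fl h ↑s) - 𝕆 (fl h ↑s)‖ ^ 2) +
            ⨆ s : Set.Icc (0:ℝ) T, ‖𝕆 (fl h ↑s)‖ ^ 2) *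
          Real.exp (t * κ) * t ^ (1 - ϱ - γ) / (1 - ϱ - γ) := by
  intro t ht
  obtain ⟨δ, hδ, hlam⟩ := hinf
  obtain ⟨C, hC⟩ := hbdd
  have hx1 : ∀ i, δ ≤ κ + lam i := fun i => by
    have := hlam i
    have := min_le_right η κ
    linarith
  have hx2 : ∀ i, κ + lam i ≤ κ + C := fun i => by
    have := (abs_le.1 (hC i)).2
    linarith
  have hx0 : ∀ i, 0 < κ + lam i := fun i => hδ.trans_le (hx1 i)
  obtain ⟨hγ0, hγ1⟩ := hγ
  obtain ⟨hϱ0, hϱ1⟩ := hϱ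
  obtain ⟨D, hD⟩ := exists_diag b (fun i => (κ + lam i) ^ ϱ) (δ ^ ϱ + (κ + C) ^ ϱ)
    (fun i => Real.rpow_nonneg (hx0 i).le _) (fun i => rpow_le_bd hδ (hx1 i) (hx2 i))
  have hsq : ∀ (r : ℝ) i, (κ + lam i) ^ (2 * r) = ((κ + lam i) ^ r) ^ 2 := fun r i => by
    rw [mul_comm, Real.rpow_mul (hx0 i).le]
    norm_num
  have hDn : ∀ v, Hnorm b κ lam ϱ v = ‖D v‖ := fun v => by
    rw [hD, Hnorm]
    simp only [hsq]
  set s1 := ⨆ s : Set.Icc (0:ℝ) T, ‖Y (fl h ↑s) - 𝕆 (fl h ↑s)‖ ^ 2 with hs1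
  set s2 := ⨆ s : Set.Icc (0:ℝ) T, ‖𝕆 (fl h ↑s)‖ ^ 2 with hs2
  have hs1n : 0 ≤ s1 := Real.iSup_nonneg (fun _ => by positivity)
  have hs2n : 0 ≤ s2 := Real.iSup_nonneg (fun _ => by positivity)
  have hb1 := bdd_fl T h hh.1 (fun u => ‖Y u - 𝕆 u‖ ^ 2)
  have hb2 := bdd_fl T h hh.1 (fun u => ‖𝕆 u‖ ^ 2)
  set K := 2 * c * (ε + s1 + s2) with hK
  have hKn : 0 ≤ K := by positivity
  have ha : 0 < 1 - ϱ - γ := by linarith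
  have hFK : ∀ s ∈ Set.Icc (0:ℝ) T, Hnorm b κ lam (-γ) (F (Y (fl h s))) ≤ K := by
    intro s hs
    refine (hFγ _).trans ?_
    have e1 : ‖Y (fl h s) - 𝕆 (fl h s)‖ ^ 2 ≤ s1 := le_ciSup hb1 ⟨s, hs⟩
    have e2 : ‖𝕆 (fl h s)‖ ^ 2 ≤ s2 := le_ciSup hb2 ⟨s, hs⟩
    have e3 : ‖Y (fl h s)‖ ≤ ‖Y (fl h s) - 𝕆 (fl h s)‖ + ‖𝕆 (fl h s)‖ := by
      simpa using norm_add_le (Y (fl h s) - 𝕆 (fl h s)) (𝕆 (fl h s))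
    have e4 : ‖Y (fl h s)‖ ^ 2 ≤ (‖Y (fl h s) - 𝕆 (fl h s)‖ + ‖𝕆 (fl h s)‖) ^ 2 :=
      pow_le_pow_left₀ (norm_nonneg _) e3 2
    have e5 : ‖Y (fl h s)‖ ^ 2 ≤ 2 * s1 + 2 * s2 := by
      nlinarith [sq_nonneg (‖Y (fl h s) - 𝕆 (fl h s)‖ - ‖𝕆 (fl h s)‖)]
    rw [hK]
    calc c * (2 * ε + ‖Y (fl h s)‖ ^ 2) ≤ c * (2 * ε + (2 * s1 + 2 * s2)) := by gcongr
      _ = _ := by ring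
  have hSb : ∀ τ, 0 < τ → τ ≤ t → ∀ w, ‖D (S τ w)‖ ≤
      (Real.exp (t * κ) * τ ^ (-(ϱ + γ))) * Hnorm b κ lam (-γ) w := by
    intro τ hτ hτt w
    have hR : 0 ≤ Real.exp (t * κ) * τ ^ (-(ϱ + γ)) := by positivity
    rw [← hDn, Hnorm, Hnorm, ← Real.sqrt_sq hR, ← Real.sqrt_mul (sq_nonneg _), ← tsum_mul_left]
    apply Real.sqrt_le_sqrt
    refine Summable.tsum_le_tsum ?_ ?_ ?_
    · intro i
      rw [inner_S b (S τ) _ (hS τ hτ.le) w i, hsq, hsq]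
      have hsm := smoothing (a := ϱ + γ) (hx0 i) hτ hτt hκ (by linarith) (by linarith)
      rw [show κ + lam i - κ = lam i by ring] at hsm
      have e1 : (κ + lam i) ^ ϱ = (κ + lam i) ^ (ϱ + γ) * (κ + lam i) ^ (-γ) := by
        rw [← Real.rpow_add (hx0 i)]
        congr 1
        ring
      have hp := Real.rpow_nonneg (hx0 i).le (ϱ + γ)
      have e2 := pow_le_pow_left₀ (by positivity) hsm 2
      have e3 := mul_le_mul_of_nonneg_right e2
        (mul_nonneg (sq_nonneg ((κ + lam i) ^ (-γ))) (sq_nonneg (inner ℝ (b i) w : ℝ)))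
      refine le_trans (le_of_eq ?_) e3
      rw [e1]
      ring
    · exact summable_wt b _ _ _ (fun i => Real.rpow_nonneg (hx0 i).le _)
        (fun i => rpow_le_bd hδ (hx1 i) (hx2 i))
    · exact (summable_wt b _ _ _ (fun i => Real.rpow_nonneg (hx0 i).le _)
        (fun i => rpow_le_bd hδ (hx1 i) (hx2 i))).mul_left _
  have hRHS : 0 ≤ K * Real.exp (t * κ) * t ^ (1 - ϱ - γ) / (1 - ϱ - γ) := by
    have := Real.rpow_nonneg ht.1 (1 - ϱ - γ)
    positivity
  rw [hDn, hY t ht, add_sub_cancel_right]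
  set f : ℝ → H := fun s =>
    if Hnorm b κ lam ϱ (Y (fl h s)) + Hnorm b κ lam ϱ (O (fl h s)) ≤ h ^ (-χ)
          then S (t - s) (F (Y (fl h s))) else 0 with hf
  by_cases hint : IntervalIntegrable f volume 0 t
  swap
  · rw [intervalIntegral.integral_undef hint, map_zero, norm_zero]
    exact hRHS
  rw [← ContinuousLinearMap.intervalIntegral_comp_comm D hint]
  have hgi0 : IntervalIntegrable (fun s : ℝ => s ^ (-(ϱ + γ))) volume 0 t :=
    intervalIntegral.intervalIntegrable_rpow' (by linarith)
  have hgi : IntervalIntegrable (fun s : ℝ => (t - s) ^ (-(ϱ + γ))) volume 0 t := by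
    have := (hgi0.comp_sub_left t).symm
    simpa using this
  have hmain := intervalIntegral.norm_integral_le_of_norm_le (μ := volume) (a := 0) (b := t)
    (f := fun s => D (f s)) (g := fun s => (K * Real.exp (t * κ)) * (t - s) ^ (-(ϱ + γ))) ht.1
    (by
      have hne : ∀ᵐ s : ℝ ∂volume, s ≠ t := by
        simp [ae_iff]
      filter_upwards [hne] with s hst hs
      have hlt : s < t := lt_of_le_of_ne hs.2 hst
      have hpos : 0 < t - s := by linarith
      have hpp := Real.rpow_pos_of_pos hpos (-(ϱ + γ))
      by_cases hcond : Hnorm b κ lam ϱ (Y (fl h s)) + Hnorm b κ lam ϱ (O (fl h s)) ≤ h ^ (-χ)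
      · simp only [hf, if_pos hcond]
        refine (hSb (t - s) hpos (by linarith [hs.1]) _).trans ?_
        have := hFK s ⟨hs.1.le, hs.2.trans ht.2⟩
        calc _ ≤ (Real.exp (t * κ) * (t - s) ^ (-(ϱ + γ))) * K := by gcongr
          _ = _ := by ring
      · simp only [hf, if_neg hcond, map_zero, norm_zero]
        positivity) (hgi.const_mul _)
  refine hmain.trans (le_of_eq ?_)
  rw [intervalIntegral.integral_const_mul,
    intervalIntegral.integral_comp_sub_left (fun s : ℝ => s ^ (-(ϱ + γ))) t, sub_self, sub_zero,
    integral_rpow (Or.inl (by linarith)), show -(ϱ + γ) + 1 = 1 - ϱ - γ by ring,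
    Real.zero_rpow ha.ne', sub_zero]
  ring
end

section
/- Let T ∈ (0,∞), η ∈ [0,∞), ϑ ∈ [0,∞), and let g : [0,T] → [0,∞) be Borel measurable. Then, with all integrals understood as Lebesgue integrals with values in [0,∞], it holds that max{1, ∫₀ᵀ η·g(u)² du} · (max{1, ∫₀ᵀ η^{1/2}·g(u) du})^{2+2ϑ} ≤ (max{1, η, T})^{4+3ϑ} · max{1, ∫₀ᵀ g(u)^{4+2ϑ} du}. -/
open MeasureTheory

theorem aux_holder {μ : Measure ℝ} {f : ℝ → ENNReal} (hf : AEMeasurable f μ) {r p : ℝ}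
    (hr : 0 < r) (hrp : r < p) :
    ∫⁻ u, f u ^ r ∂μ ≤ (∫⁻ u, f u ^ p ∂μ) ^ (r / p) * μ Set.univ ^ (1 - r / p) := by
  have hp : 0 < p := hr.trans hrp
  have hc : (p / r).HolderConjugate (p / r).conjExponent :=
    Real.HolderConjugate.conjExponent ((one_lt_div hr).2 hrp)
  have h := ENNReal.lintegral_mul_le_Lp_mul_Lq μ hc (hf.pow_const r)
    (aemeasurable_const (b := (1 : ENNReal)))
  have e1 : 1 / (p / r).conjExponent = 1 - r / p := by
    have := hc.inv_add_inv_eq_one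
    rw [inv_div] at this
    rw [one_div]; linarith
  have e2 : r * (p / r) = p := by field_simp
  simpa [← ENNReal.rpow_mul, e1, e2, one_div_div] using h

/-- an elementary Hölder-type estimate in the extended nonnegative reals. -/
theorem stmt9 (T η ϑ : ℝ) (hT : 0 < T) (hη : 0 ≤ η) (hϑ : 0 ≤ ϑ)
    (g : ℝ → ℝ)
    (hgmeas : Measurable fun u : Set.Icc (0:ℝ) T => g ↑u)
    (hg0 : ∀ u ∈ Set.Icc (0:ℝ) T, 0 ≤ g u) :
    max 1 (∫⁻ u in Set.Icc (0:ℝ) T, ENNReal.ofReal (η * g u ^ 2)) *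
        (max 1 (∫⁻ u in Set.Icc (0:ℝ) T, ENNReal.ofReal (Real.sqrt η * g u))) ^ (2 + 2 * ϑ) ≤
      ENNReal.ofReal (max (max 1 η) T) ^ (4 + 3 * ϑ) *
        max 1 (∫⁻ u in Set.Icc (0:ℝ) T, ENNReal.ofReal (g u ^ (4 + 2 * ϑ))) := by
  have hg : AEMeasurable g (volume.restrict (Set.Icc (0:ℝ) T)) := by
    rw [aemeasurable_restrict_iff_comap_subtype measurableSet_Icc]
    exact hgmeas.aemeasurable
  have hf : AEMeasurable (fun u => ENNReal.ofReal (g u)) (volume.restrict (Set.Icc (0:ℝ) T)) :=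
    hg.ennreal_ofReal
  obtain ⟨p, hpdef⟩ : ∃ p, p = 4 + 2 * ϑ := ⟨_, rfl⟩
  have hp4 : 4 ≤ p := by linarith
  have i1 : ∫⁻ u in Set.Icc (0:ℝ) T, ENNReal.ofReal (η * g u ^ 2)
      = ENNReal.ofReal η * ∫⁻ u in Set.Icc (0:ℝ) T, ENNReal.ofReal (g u) ^ (2:ℝ) := by
    rw [← lintegral_const_mul' _ _ ENNReal.ofReal_ne_top]
    refine setLIntegral_congr_fun measurableSet_Icc fun u hu => ?_
    rw [ENNReal.ofReal_mul hη, ENNReal.ofReal_pow (hg0 u hu)]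
    norm_cast
  have i2 : ∫⁻ u in Set.Icc (0:ℝ) T, ENNReal.ofReal (Real.sqrt η * g u)
      = ENNReal.ofReal η ^ (1/2:ℝ) * ∫⁻ u in Set.Icc (0:ℝ) T, ENNReal.ofReal (g u) ^ (1:ℝ) := by
    rw [← lintegral_const_mul' _ _ (ENNReal.rpow_ne_top_of_nonneg (by norm_num)
      ENNReal.ofReal_ne_top)]
    refine setLIntegral_congr_fun measurableSet_Icc fun u hu => ?_
    rw [ENNReal.ofReal_mul (Real.sqrt_nonneg _), Real.sqrt_eq_rpow,
      ENNReal.ofReal_rpow_of_nonneg hη (by norm_num), ENNReal.rpow_one]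
  have i3 : ∫⁻ u in Set.Icc (0:ℝ) T, ENNReal.ofReal (g u ^ (4 + 2 * ϑ))
      = ∫⁻ u in Set.Icc (0:ℝ) T, ENNReal.ofReal (g u) ^ p := by
    refine setLIntegral_congr_fun measurableSet_Icc fun u hu => ?_
    rw [ENNReal.ofReal_rpow_of_nonneg (hg0 u hu) (by linarith), hpdef]
  have h2 := aux_holder hf (r := 2) (p := p) (by norm_num) (by linarith)
  have h1 := aux_holder hf (r := 1) (p := p) (by norm_num) (by linarith)
  rw [Measure.restrict_apply_univ, Real.volume_Icc, sub_zero] at h1 h2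
  rw [i1, i2, i3]
  set G := ∫⁻ u in Set.Icc (0:ℝ) T, ENNReal.ofReal (g u) ^ p
  set J := max 1 G
  set M := ENNReal.ofReal (max (max 1 η) T)
  have hM1 : 1 ≤ M := by
    rw [← ENNReal.ofReal_one]; exact ENNReal.ofReal_le_ofReal (by simp)
  have hMη : ENNReal.ofReal η ≤ M := ENNReal.ofReal_le_ofReal (by simp)
  have hMT : ENNReal.ofReal T ≤ M := ENNReal.ofReal_le_ofReal (by simp)
  have hM0 : M ≠ 0 := (zero_lt_one.trans_le hM1).ne'
  have hMt : M ≠ ⊤ := ENNReal.ofReal_ne_top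
  have hJ1 : 1 ≤ J := le_max_left _ _
  have hJ : G ≤ J := le_max_right _ _
  have p2 : 2 / p ≤ 1 := by rw [div_le_one (by linarith)]; linarith
  have p1 : 1 / p ≤ 1 := by rw [div_le_one (by linarith)]; linarith
  have p20 : 0 ≤ 2 / p := by positivity
  have p10 : 0 ≤ 1 / p := by positivity
  have q1 : 0 ≤ 1 - 1 / p := by linarith
  have q2 : 0 ≤ 1 - 2 / p := by linarith
  have A : max 1 (ENNReal.ofReal η * ∫⁻ u in Set.Icc (0:ℝ) T, ENNReal.ofReal (g u) ^ (2:ℝ))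
      ≤ M ^ (2 - 2 / p) * J ^ (2 / p) := by
    refine max_le ?_ ?_
    · exact one_le_mul (ENNReal.one_le_rpow hM1 (by linarith))
        (ENNReal.one_le_rpow hJ1 (by positivity))
    · calc _ ≤ M * (J ^ (2 / p) * M ^ (1 - 2 / p)) := by
            refine mul_le_mul' hMη (h2.trans ?_)
            gcongr
        _ = M ^ (1:ℝ) * M ^ (1 - 2 / p) * J ^ (2 / p) := by rw [ENNReal.rpow_one]; ring
        _ = _ := by rw [← ENNReal.rpow_add _ _ hM0 hMt]; congr 2; ring
  have B : max 1 (ENNReal.ofReal η ^ (1/2:ℝ) *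
        ∫⁻ u in Set.Icc (0:ℝ) T, ENNReal.ofReal (g u) ^ (1:ℝ))
      ≤ M ^ (3 / 2 - 1 / p) * J ^ (1 / p) := by
    refine max_le ?_ ?_
    · exact one_le_mul (ENNReal.one_le_rpow hM1 (by linarith))
        (ENNReal.one_le_rpow hJ1 (by positivity))
    · calc _ ≤ M ^ (1/2:ℝ) * (J ^ (1 / p) * M ^ (1 - 1 / p)) := by
            refine mul_le_mul' (by gcongr) (h1.trans ?_)
            gcongr
        _ = M ^ (1/2:ℝ) * M ^ (1 - 1 / p) * J ^ (1 / p) := by ring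
        _ = _ := by rw [← ENNReal.rpow_add _ _ hM0 hMt]; congr 2; ring
  have hs : 0 ≤ 2 + 2 * ϑ := by linarith
  calc _ ≤ (M ^ (2 - 2 / p) * J ^ (2 / p)) * (M ^ (3 / 2 - 1 / p) * J ^ (1 / p)) ^ (2 + 2 * ϑ) :=
        mul_le_mul' A (ENNReal.rpow_le_rpow B hs)
    _ = (M ^ (2 - 2 / p) * M ^ ((3 / 2 - 1 / p) * (2 + 2 * ϑ))) *
        (J ^ (2 / p) * J ^ (1 / p * (2 + 2 * ϑ))) := by
        rw [ENNReal.mul_rpow_of_nonneg _ _ hs, ← ENNReal.rpow_mul, ← ENNReal.rpow_mul]; ring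
    _ = M ^ (4 + 3 * ϑ) * J ^ (1:ℝ) := by
        have hp0 : p ≠ 0 := by linarith
        rw [← ENNReal.rpow_add _ _ hM0 hMt,
          ← ENNReal.rpow_add_of_nonneg _ _ p20 (by positivity)]
        have hϑp : ϑ = (p - 4) / 2 := by linarith
        congr 2
        · rw [hϑp]; field_simp; ring
        · rw [hϑp]; field_simp; ring
    _ = _ := by rw [ENNReal.rpow_one]
end

section
/- Let κ ∈ [0,∞), T ∈ (0,∞), a ∈ [0,1), and ε ∈ (0, 1−a). Then: (i) for every nonempty countable set Λ ⊆ (−κ, ∞) it holds that ∫₀ᵀ sup_{λ∈Λ} ((κ+λ)^a · e^{−sλ}) ds ≤ e^{Tκ} · (sup_{λ∈Λ} (κ+λ)^{−ε}) · T^{1−a−ε} / (1−a−ε); and (ii) for every sequence (Λ_n)_{n∈ℕ} of nonempty countable subsets of (−κ, ∞) with lim_{n→∞} inf Λ_n = ∞ it holds that lim_{n→∞} ∫₀ᵀ sup_{λ∈Λ_n} ((κ+λ)^a · e^{−sλ}) ds = 0. (In the diagonal spectral setting, sup_{λ∈Λ_n} (κ+λ)^a e^{−sλ} equals the operator norm ‖(Id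 − P_n) e^{sA}‖ from H_{−α} to H_ϱ with a = ϱ+α, where Λ_n is the set of eigenvalues λ_i with index outside the n-th spectral projection; the statement is the vanishing of ∫₀ᵀ ‖(Id_{H_ϱ} − P_n) e^{sA}‖_{L(H_{−α},H_ϱ)} ds as the spectral cutoff tends to infinity.) -/
open MeasureTheory

lemma aux_pt (x s b : ℝ) (hx : 0 < x) (hs : 0 < s) (hb : 0 ≤ b) (hb1 : b ≤ 1) :
    x ^ b * Real.exp (-(s * x)) ≤ s ^ (-b) := by
  have hy : 0 < s * x := mul_pos hs hx
  have h1 : (s * x) ^ b ≤ Real.exp (s * x) := by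
    calc (s * x) ^ b ≤ (Real.exp (s * x)) ^ b :=
          Real.rpow_le_rpow hy.le (by linarith [Real.add_one_le_exp (s * x)]) hb
      _ ≤ (Real.exp (s * x)) ^ (1:ℝ) :=
          Real.rpow_le_rpow_of_exponent_le (Real.one_le_exp hy.le) hb1
      _ = _ := Real.rpow_one _
  rw [Real.mul_rpow hs.le hx.le] at h1
  have hsb : 0 < s ^ b := Real.rpow_pos_of_pos hs b
  rw [Real.exp_neg, Real.rpow_neg hs.le, ← div_eq_mul_inv, div_le_iff₀ (Real.exp_pos _),
    inv_mul_eq_div, le_div_iff₀ hsb]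
  linarith

lemma aux_int (T b : ℝ) (hT : 0 < T) (hb1 : b < 1) :
    ∫⁻ s in Set.Ioc (0:ℝ) T, ENNReal.ofReal (s ^ (-b)) = ENNReal.ofReal (T ^ (1 - b) / (1 - b)) := by
  have hi : IntervalIntegrable (fun s : ℝ => s ^ (-b)) volume 0 T :=
    intervalIntegral.intervalIntegrable_rpow' (by linarith)
  rw [intervalIntegrable_iff_integrableOn_Ioc_of_le hT.le] at hi
  rw [← ofReal_integral_eq_lintegral_ofReal hi, ← intervalIntegral.integral_of_le hT.le,
    integral_rpow (Or.inl (by linarith)), Real.zero_rpow (by linarith)]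
  · congr 1
    rw [sub_zero, neg_add_eq_sub]
  · filter_upwards [ae_restrict_mem measurableSet_Ioc] with s hs
    exact Real.rpow_nonneg hs.1.le _

lemma aux_main (κ T a ε : ℝ) (hκ : 0 ≤ κ) (hT : 0 < T)
    (ha : a ∈ Set.Ico (0:ℝ) 1) (hε : ε ∈ Set.Ioo (0:ℝ) (1 - a))
    (Λ : Set ℝ) (hΛ : ∀ l ∈ Λ, -κ < l) :
      (∫⁻ s in Set.Icc (0:ℝ) T,
          ⨆ l ∈ Λ, ENNReal.ofReal ((κ + l) ^ a * Real.exp (-(s * l)))) ≤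
        ENNReal.ofReal (Real.exp (T * κ)) * (⨆ l ∈ Λ, ENNReal.ofReal ((κ + l) ^ (-ε))) *
          ENNReal.ofReal (T ^ (1 - a - ε) / (1 - a - ε)) := by
  obtain ⟨ha0, ha1⟩ := ha
  obtain ⟨he0, he1⟩ := hε
  rw [setLIntegral_congr Ioc_ae_eq_Icc.symm, sub_sub,
    ← aux_int T (a + ε) hT (by linarith), ← lintegral_const_mul _ (by fun_prop)]
  refine setLIntegral_mono' measurableSet_Ioc fun s hs => ?_
  refine iSup₂_le fun l hl => ?_
  have hx : 0 < κ + l := by linarith [hΛ l hl]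
  have key : (κ + l) ^ a * Real.exp (-(s * l)) ≤
      Real.exp (T * κ) * (κ + l) ^ (-ε) * s ^ (-(a + ε)) := by
    have h1 := aux_pt (κ + l) s (a + ε) hx hs.1 (by linarith) (by linarith)
    have e1 : (κ + l) ^ a * Real.exp (-(s * l)) = Real.exp (s * κ) * (κ + l) ^ (-ε) *
        ((κ + l) ^ (a + ε) * Real.exp (-(s * (κ + l)))) := by
      have h2 : (κ + l) ^ a = (κ + l) ^ (-ε) * (κ + l) ^ (a + ε) := by
        rw [← Real.rpow_add hx]; congr 1; ring
      have h3 : Real.exp (-(s * l)) = Real.exp (s * κ) * Real.exp (-(s * (κ + l))) := by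
        rw [← Real.exp_add]; congr 1; ring
      rw [h2, h3]; ring
    rw [e1]
    have h4 : Real.exp (s * κ) ≤ Real.exp (T * κ) :=
      Real.exp_le_exp.2 (mul_le_mul_of_nonneg_right hs.2 hκ)
    have := Real.rpow_nonneg hx.le (-ε)
    have := Real.rpow_nonneg hx.le (a + ε)
    gcongr
  refine (ENNReal.ofReal_le_ofReal key).trans ?_
  have := Real.rpow_nonneg hx.le (-ε)
  rw [ENNReal.ofReal_mul (by positivity), ENNReal.ofReal_mul (by positivity)]
  gcongr
  exact le_iSup₂ (f := fun l _ => ENNReal.ofReal ((κ + l) ^ (-ε))) l hl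

/-- integral bound and vanishing of
`∫₀ᵀ sup_{λ∈Λ} (κ+λ)^a e^{-sλ} ds` as the spectral cutoff tends to infinity. -/
theorem stmt11 (κ T a ε : ℝ) (hκ : 0 ≤ κ) (hT : 0 < T)
    (ha : a ∈ Set.Ico (0:ℝ) 1) (hε : ε ∈ Set.Ioo (0:ℝ) (1 - a)) :
    (∀ Λ : Set ℝ, Λ.Countable → Λ.Nonempty → (∀ l ∈ Λ, -κ < l) →
      (∫⁻ s in Set.Icc (0:ℝ) T,
          ⨆ l ∈ Λ, ENNReal.ofReal ((κ + l) ^ a * Real.exp (-(s * l)))) ≤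
        ENNReal.ofReal (Real.exp (T * κ)) * (⨆ l ∈ Λ, ENNReal.ofReal ((κ + l) ^ (-ε))) *
          ENNReal.ofReal (T ^ (1 - a - ε) / (1 - a - ε))) ∧
    (∀ Λ : ℕ → Set ℝ, (∀ n, (Λ n).Countable) → (∀ n, (Λ n).Nonempty) →
      (∀ n, ∀ l ∈ Λ n, -κ < l) →
      Filter.Tendsto (fun n => sInf (Λ n)) Filter.atTop Filter.atTop →
      Filter.Tendsto
        (fun n => ∫⁻ s in Set.Icc (0:ℝ) T,
          ⨆ l ∈ Λ n, ENNReal.ofReal ((κ + l) ^ a * Real.exp (-(s * l))))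
        Filter.atTop (nhds 0)) := by
  refine ⟨fun Λ _ _ hΛ => aux_main κ T a ε hκ hT ha hε Λ hΛ, ?_⟩
  intro Λ _ hne hΛ hlim
  have h1 : Filter.Tendsto (fun n => (κ + sInf (Λ n)) ^ (-ε)) Filter.atTop (nhds 0) :=
    (tendsto_rpow_neg_atTop hε.1).comp (Filter.tendsto_atTop_add_const_left _ κ hlim)
  have h2 := ENNReal.tendsto_ofReal h1
  rw [ENNReal.ofReal_zero] at h2
  have h3 : Filter.Tendsto (fun n => ENNReal.ofReal (Real.exp (T * κ)) *
      ENNReal.ofReal ((κ + sInf (Λ n)) ^ (-ε)) *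
      ENNReal.ofReal (T ^ (1 - a - ε) / (1 - a - ε))) Filter.atTop (nhds 0) := by
    have := ENNReal.Tendsto.mul_const (b := ENNReal.ofReal (T ^ (1 - a - ε) / (1 - a - ε)))
      (ENNReal.Tendsto.const_mul (a := ENNReal.ofReal (Real.exp (T * κ))) h2
        (Or.inr ENNReal.ofReal_ne_top)) (Or.inr ENNReal.ofReal_ne_top)
    simpa using this
  refine tendsto_of_tendsto_of_tendsto_of_le_of_le' tendsto_const_nhds h3
    (Filter.Eventually.of_forall fun n => zero_le) ?_
  filter_upwards [hlim.eventually_gt_atTop 0] with n hn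
  refine (aux_main κ T a ε hκ hT ha hε (Λ n) (hΛ n)).trans ?_
  gcongr
  refine iSup₂_le fun l hl => ENNReal.ofReal_le_ofReal ?_
  have hle : sInf (Λ n) ≤ l := csInf_le ⟨-κ, fun x hx => (hΛ n x hx).le⟩ hl
  exact Real.rpow_le_rpow_of_nonpos (by linarith) (by linarith) (by linarith [hε.1])
end
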